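/- For every integer n ≥ 3, the configuration W on the graph H_n is a fixed point of the 1/2-power index process; that is, if C_0 = W then C_1 = W. -/

import Mathlib

open scoped Classical

/-- A strategy of a voter: collaborator (`C`) or defector (`D`). -/
inductive Strategy : Type
  | C : Strategy
  | D : Strategy
deriving DecidableEq

noncomputable section

variable {V : Type*}

/-- The closed neighbourhood `N[v]` of a vertex, as a finset. -/
def closedNbhd (G : SimpleGraph V) [Fintype V] (v : V) : Finset V :=
  Finset.univ.filter fun u => u = v ∨ G.Adj u v

/-- The (Shapley–Shubik style) power of a vertex `v` in configuration `c`
with win condition `w`. -/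
def power (G : SimpleGraph V) [Fintype V] (w : ℝ) (c : V → Strategy) (v : V) : ℝ :=
  let N := closedNbhd G v
  let nC := (N.filter fun u => c u = Strategy.C).card
  let nD := (N.filter fun u => c u = Strategy.D).card
  match c v with
  | Strategy.C => if w < (nC : ℝ) / (N.card : ℝ) then 1 / (nC : ℝ) else 0
  | Strategy.D => if (nC : ℝ) / (N.card : ℝ) ≤ w then 1 / (nD : ℝ) else 0

/-- One step of the `w`-power index process: every vertex adopts the strategy of a
vertex of maximum power in its closed neighbourhood, retaining its own strategy if
vertices of maximum power have differing strategies. -/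
def step (G : SimpleGraph V) [Fintype V] (w : ℝ) (c : V → Strategy) (v : V) : Strategy :=
  let N := closedNbhd G v
  let M := N.filter fun u => ∀ x ∈ N, power G w c x ≤ power G w c u
  if ∀ u ∈ M, c u = Strategy.C then Strategy.C
  else if ∀ u ∈ M, c u = Strategy.D then Strategy.D
  else c v

/-- `configSeq G w c0 i` is the configuration `C_i` of the `w`-power index process. -/
def configSeq (G : SimpleGraph V) [Fintype V] (w : ℝ) (c0 : V → Strategy) : ℕ → V → Strategy
  | 0 => c0
  | k + 1 => step G w (configSeq G w c0 k)

/-- The process is eventually stable. -/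
def EventuallyStable (G : SimpleGraph V) [Fintype V] (w : ℝ) (c0 : V → Strategy) : Prop :=
  ∃ i, configSeq G w c0 (i + 1) = configSeq G w c0 i

/-- The process reaches a stable all-collaborator configuration. -/
def CollaboratorDominant (G : SimpleGraph V) [Fintype V] (w : ℝ) (c0 : V → Strategy) : Prop :=
  ∃ i, configSeq G w c0 (i + 1) = configSeq G w c0 i ∧
    ∀ v, configSeq G w c0 i v = Strategy.C

/-- The process reaches a stable all-defector configuration. -/
def DefectorDominant (G : SimpleGraph V) [Fintype V] (w : ℝ) (c0 : V → Strategy) : Prop :=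
  ∃ i, configSeq G w c0 (i + 1) = configSeq G w c0 i ∧
    ∀ v, configSeq G w c0 i v = Strategy.D

/-- The process is eventually periodic with period `ℓ`: `ℓ > 1` is the least integer
such that `C_i = C_{i+ℓ}` for some `i ≥ 0`. -/
def EventuallyPeriodicWithPeriod (G : SimpleGraph V) [Fintype V] (w : ℝ)
    (c0 : V → Strategy) (ℓ : ℕ) : Prop :=
  IsLeast {m : ℕ | 1 < m ∧ ∃ i, configSeq G w c0 (i + m) = configSeq G w c0 i} ℓ

end

/-- Vertices of the graph `H_n`: a pair `(i, (j, t))` where `i ∈ ℤ/n` is the column,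
`j ∈ {0, 1}` is the row (row `0` is row "1" of the paper, row `1` is row "2"),
and `t` records the kind of vertex: `t = 0` is `v_{i,j}` (a vertex of `C_n □ P_2`),
`t = 1` is `z_{i,j}` (the triangle vertex joined to `v_{i,j}`), and `t = 2, 3`
are `x_{i,j}, y_{i,j}` (the other two triangle vertices). -/
abbrev HVertex (n : ℕ) : Type := ZMod n × Fin 2 × Fin 4

/-- The graph `H_n`, obtained from `C_n □ P_2` by attaching, to each vertex
`v_{i,j}`, a pendant triangle `x_{i,j} y_{i,j} z_{i,j}` via the edge
`v_{i,j} z_{i,j}`. -/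
def Hgraph (n : ℕ) : SimpleGraph (HVertex n) :=
  SimpleGraph.fromRel fun a b =>
    -- cycle edges of each row: v_{i,j} ~ v_{i+1,j}
    (a.2.2 = 0 ∧ b.2.2 = 0 ∧ a.2.1 = b.2.1 ∧ b.1 = a.1 + 1) ∨
    -- rung edges: v_{i,0} ~ v_{i,1}
    (a.2.2 = 0 ∧ b.2.2 = 0 ∧ a.1 = b.1 ∧ a.2.1 ≠ b.2.1) ∨
    -- triangle edges among x, y, z at the same (i, j)
    (a.1 = b.1 ∧ a.2.1 = b.2.1 ∧ a.2.2 ≠ 0 ∧ b.2.2 ≠ 0) ∨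
    -- pendant edges: v_{i,j} ~ z_{i,j}
    (a.1 = b.1 ∧ a.2.1 = b.2.1 ∧ a.2.2 = 0 ∧ b.2.2 = 1)

/-- The configuration `W` on `H_n`: all vertices of row `0` (the paper's row `1`)
are collaborators, all vertices of row `1` (the paper's row `2`) are defectors. -/
def Wconfig (n : ℕ) : HVertex n → Strategy :=
  fun a => if a.2.1 = 0 then Strategy.C else Strategy.D

noncomputable section

/-- The `C`-wave configuration on `H_n` with interrupter columns `I`: the
configuration `W` with the strategies of the vertices `v_{i,2}` (`i ∈ I`) flipped
from `D` to `C`. -/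
def CwaveConfig (n : ℕ) (I : Set (ZMod n)) : HVertex n → Strategy :=
  fun a => if a.2.1 = 0 then Strategy.C
    else if a.2.2 = 0 ∧ a.1 ∈ I then Strategy.C else Strategy.D

/-- The `D`-wave configuration on `H_n` with interrupter columns `I`: the
configuration `W` with the strategies of the vertices `v_{i,1}` (`i ∈ I`) flipped
from `C` to `D`. -/
def DwaveConfig (n : ℕ) (I : Set (ZMod n)) : HVertex n → Strategy :=
  fun a => if a.2.1 = 0 then
    (if a.2.2 = 0 ∧ a.1 ∈ I then Strategy.D else Strategy.C) else Strategy.D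

/-- A set of interrupter columns is admissible for a wave configuration when all its
columns have the same parity. -/
def SameParity {n : ℕ} (I : Set (ZMod n)) : Prop :=
  ∃ p : ZMod 2, ∀ i ∈ I, ((i.val : ℕ) : ZMod 2) = p

end

theorem step_eq_self {V : Type*} (G : SimpleGraph V) [Fintype V] (w : ℝ) (c : V → Strategy) (v u : V)
    (hu : u ∈ closedNbhd G v) (hmax : ∀ x ∈ closedNbhd G v, power G w c x ≤ power G w c u)
    (hc : c u = c v) : step G w c v = c v := by
  have hM : u ∈ (closedNbhd G v).filter
      (fun u => ∀ x ∈ closedNbhd G v, power G w c x ≤ power G w c u) := by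
    rw [Finset.mem_filter]
    exact ⟨hu, hmax⟩
  unfold step
  dsimp only
  split_ifs with h1 h2
  · rw [← hc, h1 u hM]
  · rw [← hc, h2 u hM]
  · rfl

theorem nbhd_v (n : ℕ) [NeZero n] (i : ZMod n) (j : Fin 2) :
    closedNbhd (Hgraph n) (i, j, 0) =
      {(i, j, 0), (i + 1, j, 0), (i - 1, j, 0), (i, 1 - j, 0), (i, j, 1)} ∨ n = 1 := by
  by_cases hn : n = 1
  · exact Or.inr hn
  left
  have h1 : (1 : ZMod n) ≠ 0 := by
    have : Fact (1 < n) := ⟨by have := NeZero.ne n; omega⟩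
    exact one_ne_zero
  ext ⟨a, b, t⟩
  have e : i = a + 1 ↔ a = i - 1 := by
    rw [eq_sub_iff_add_eq, eq_comm]
  have e' : a = i ↔ i = a := eq_comm
  fin_cases t <;> fin_cases j <;> fin_cases b <;>
    simp [closedNbhd, Hgraph, SimpleGraph.fromRel_adj, e, e'] <;> grind

theorem nbhd_z (n : ℕ) [NeZero n] (i : ZMod n) (j : Fin 2) :
    closedNbhd (Hgraph n) (i, j, 1) =
      {(i, j, 0), (i, j, 1), (i, j, 2), (i, j, 3)} := by
  ext ⟨a, b, t⟩
  fin_cases t <;> simp [closedNbhd, Hgraph, SimpleGraph.fromRel_adj] <;> grind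

theorem power_z (n : ℕ) [NeZero n] (i : ZMod n) (j : Fin 2) :
    power (Hgraph n) (1 / 2) (Wconfig n) (i, j, 1) = 1 / 4 := by
  unfold power
  rw [nbhd_z]
  fin_cases j <;> simp [Wconfig, Finset.filter_insert, Finset.filter_singleton] <;> norm_num

theorem power_v (n : ℕ) [NeZero n] (hn : 3 ≤ n) (i : ZMod n) (j : Fin 2) :
    power (Hgraph n) (1 / 2) (Wconfig n) (i, j, 0) = 1 / 4 := by
  have h1 : (1 : ZMod n) ≠ 0 := by
    have : Fact (1 < n) := ⟨by omega⟩
    exact one_ne_zero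
  have h2 : (2 : ZMod n) ≠ 0 := by
    intro h
    have h' : ((2 : ℕ) : ZMod n) = 0 := by exact_mod_cast h
    rw [ZMod.natCast_eq_zero_iff] at h'
    have := Nat.le_of_dvd (by norm_num) h'
    omega
  have a1 : i + 1 ≠ i - 1 := by
    intro h
    apply h2
    linear_combination h
  have a2 : i ≠ i - 1 := by
    intro h
    apply h1
    linear_combination h
  unfold power
  rw [(nbhd_v n i j).resolve_right (by omega)]
  fin_cases j <;> simp [Wconfig, Finset.filter_insert, Finset.filter_singleton, a1, a2, h1] <;>
    norm_num

/-- For every `n ≥ 3` the configuration `W` on `H_n` is a fixed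
point of the `1/2`-power index process. -/
theorem statement9 (n : ℕ) [NeZero n] (hn : 3 ≤ n) :
    configSeq (Hgraph n) (1 / 2) (Wconfig n) 1 = Wconfig n := by
  funext v
  change step (Hgraph n) (1 / 2) (Wconfig n) v = Wconfig n v
  obtain ⟨i, j, t⟩ := v
  by_cases ht : t = 0
  · subst ht
    refine step_eq_self _ _ _ _ (i, j, 0) (by simp [closedNbhd]) ?_ rfl
    intro x hx
    rw [(nbhd_v n i j).resolve_right (by omega)] at hx
    simp only [Finset.mem_insert, Finset.mem_singleton] at hx
    rw [power_v n hn]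
    rcases hx with rfl | rfl | rfl | rfl | rfl
    · exact (power_v n hn _ _).le
    · exact (power_v n hn _ _).le
    · exact (power_v n hn _ _).le
    · exact (power_v n hn _ _).le
    · exact (power_z n _ _).le
  · obtain ⟨u, hu, hmax⟩ := Finset.exists_max_image (closedNbhd (Hgraph n) (i, j, t))
      (power (Hgraph n) (1 / 2) (Wconfig n)) ⟨(i, j, t), by simp [closedNbhd]⟩
    refine step_eq_self _ _ _ _ u hu hmax ?_
    have hrow : u.2.1 = j := by
      simp only [closedNbhd, Hgraph, SimpleGraph.fromRel_adj, Finset.mem_filter] at hu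
      grind
    simp [Wconfig, hrow]
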